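/- Let (Q,·,\,1) be a uniquely 2-divisible commutative automorphic loop with associated Bruck loop operation x∘y := √(P_x(y·y)). Then the centers of (Q,·) and (Q,∘) coincide: for a ∈ Q, one has (x·y)·a = x·(y·a) for all x,y ∈ Q if and only if a∘(x∘y) = x∘(a∘y) for all x,y ∈ Q. -/

import Mathlib

/-- A commutative automorphic loop, presented by its left translations. -/
structure CommAutomorphicLoop (Q : Type*) where
  /-- The left translations. -/
  L : Q → Equiv.Perm Q
  /-- The identity element. -/
  e : Q
  L_e : L e = 1
  comm : ∀ x y, L x y = L y x
  inner_mul : ∀ x y u v, ((L (L y x))⁻¹ * (L y * L x)) (L u v) =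
    L (((L (L y x))⁻¹ * (L y * L x)) u) (((L (L y x))⁻¹ * (L y * L x)) v)

namespace CommAutomorphicLoop

variable {Q : Type*} (C : CommAutomorphicLoop Q)

/-- The inner mapping `z ↦ (y·x)\(y·(x·z))`. -/
def inner (x y : Q) : Equiv.Perm Q := (C.L (C.L y x))⁻¹ * (C.L y * C.L x)

/-- The inverse `x \ 1`. -/
def inv (x : Q) : Q := (C.L x)⁻¹ C.e

/-- The map `P_x = L_{x⁻¹}⁻¹ L_x`. -/
def P (x : Q) : Equiv.Perm Q := (C.L (C.inv x))⁻¹ * C.L x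

/-- Automorphisms, expressed by their action on left translations. -/
def IsAut (f : Equiv.Perm Q) : Prop := ∀ u, f * C.L u = C.L (f u) * f

lemma L_apply_e (x : Q) : C.L x C.e = x := by rw [C.comm, C.L_e]; rfl

lemma L_injective : Function.Injective C.L := fun x y h => by
  rw [← C.L_apply_e x, h, L_apply_e]

lemma L_apply_inv (x : Q) : C.L x (C.inv x) = C.e := (C.L x).apply_symm_apply C.e

lemma L_inv_apply (x : Q) : C.L (C.inv x) x = C.e := by rw [C.comm, L_apply_inv]

lemma eq_inv_of_L_apply {x y : Q} (h : C.L x y = C.e) : y = C.inv x :=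
  (C.L x).injective (h.trans (C.L_apply_inv x).symm)

lemma inv_inv (x : Q) : C.inv (C.inv x) = x := (C.eq_inv_of_L_apply (C.L_inv_apply x)).symm

lemma isAut_inner (x y : Q) : C.IsAut (C.inner x y) := fun u =>
  Equiv.ext fun v => C.inner_mul x y u v

lemma L_mul_L (x y : Q) : C.L y * C.L x = C.L (C.L y x) * C.inner x y := by simp [inner]

variable {C}

lemma IsAut.map_mul {f : Equiv.Perm Q} (hf : C.IsAut f) (u v : Q) :
    f (C.L u v) = C.L (f u) (f v) := congrArg (fun g => g v) (hf u)

lemma IsAut.map_e {f : Equiv.Perm Q} (hf : C.IsAut f) : f C.e = C.e := by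
  have h := hf C.e
  rw [C.L_e, mul_one, right_eq_mul] at h
  exact C.L_injective (h.trans C.L_e.symm)

lemma IsAut.map_inv {f : Equiv.Perm Q} (hf : C.IsAut f) (u : Q) : f (C.inv u) = C.inv (f u) :=
  C.eq_inv_of_L_apply (by rw [← hf.map_mul, L_apply_inv, hf.map_e])

variable (C)

lemma isAut_L_inv_mul_L (x : Q) : C.IsAut (C.L (C.inv x) * C.L x) := by
  have h := C.isAut_inner x (C.inv x)
  rwa [inner, L_inv_apply, L_e, inv_one, one_mul] at h

lemma commute_L_inv_L (x : Q) : Commute (C.L (C.inv x)) (C.L x) := by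
  have h := C.isAut_L_inv_mul_L x (C.inv x)
  rw [Equiv.Perm.mul_apply, L_apply_inv, L_apply_e, mul_assoc] at h
  exact (mul_left_cancel h).symm

lemma P_eq (x : Q) : C.P x = C.L x * (C.L (C.inv x))⁻¹ :=
  (C.commute_L_inv_L x).inv_left.eq

lemma inner_apply_inv (x y : Q) :
    C.inner x y (C.inv x) = (C.L (C.L y x))⁻¹ y := by
  simp [inner, L_apply_inv, L_apply_e]

lemma inner_apply_self (x y : Q) :
    C.inner x y x = C.inv ((C.L (C.L y x))⁻¹ y) := by
  rw [← inner_apply_inv, (C.isAut_inner x y).map_inv, inv_inv]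

lemma conj_L (x y : Q) : C.L x * C.L y * (C.L x)⁻¹ =
    C.L (C.L x y) * C.L (C.inv ((C.L (C.L x y))⁻¹ x)) * (C.L (C.L x y))⁻¹ := by
  have h := C.isAut_inner y x y
  rw [inner_apply_self, ← mul_inv_eq_iff_eq_mul] at h
  rw [← h, inner]
  group

lemma inv_L (x y : Q) : C.inv (C.L x y) = C.L (C.inv x) (C.inv y) := by
  have key : ∀ z w, C.L (C.inv (C.L z w)) z = C.L (C.inv z) (C.L z (C.inv w)) := by
    intro z w
    obtain ⟨y, hy⟩ := (C.L (C.L z w)).surjective z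
    have h := congrArg (fun f => f C.e) (C.conj_L (C.L z w) y)
    have hw : (C.L z)⁻¹ (C.L z w) = w := (C.L z).symm_apply_apply w
    rw [hy, hw] at h
    change C.L (C.L z w) (C.L y (C.inv (C.L z w))) = C.L z (C.L (C.inv w) (C.inv z)) at h
    rw [C.comm y, C.comm (C.inv w)] at h
    have h1 := congrArg (fun f => f y) (C.commute_L_inv_L (C.L z w)).eq
    have h2 := congrArg (fun f => f (C.inv w)) (C.commute_L_inv_L z).eq
    simp only [Equiv.Perm.mul_apply] at h1 h2
    rw [hy] at h1
    rw [h1, h, h2]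
  obtain ⟨w, hw⟩ := (C.L (C.inv y)).surjective (C.inv (C.inv x))
  have h := key (C.inv y) w
  have hθ := (C.isAut_L_inv_mul_L (C.inv y)).map_inv w
  simp only [Equiv.Perm.mul_apply] at hθ
  rw [hθ, hw] at h
  simp only [inv_inv] at h
  rw [h, C.comm y]

/-- Inversion as a permutation. -/
def J : Equiv.Perm Q := ⟨C.inv, C.inv, C.inv_inv, C.inv_inv⟩

lemma conj_J_L (x : Q) : MulAut.conj C.J (C.L x) = C.L (C.inv x) := by
  rw [MulAut.conj_apply, mul_inv_eq_iff_eq_mul]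
  exact Equiv.ext fun u => C.inv_L x u

lemma conj_J_inner (x y : Q) : MulAut.conj C.J (C.inner x y) = C.inner x y := by
  rw [MulAut.conj_apply, mul_inv_eq_iff_eq_mul]
  exact Equiv.ext fun u => ((C.isAut_inner x y).map_inv u).symm

lemma inner_inv_inv (x y : Q) : C.inner (C.inv x) (C.inv y) = C.inner x y := by
  rw [← C.conj_J_inner x y, inner, inner]
  simp only [map_mul, _root_.map_inv, conj_J_L, inv_L]

lemma P_L (x y : Q) : C.P (C.L x y) = C.L x * C.P y * (C.L (C.inv x))⁻¹ := by
  have h1 : C.L (C.L x y) = C.L x * C.L y * (C.inner y x)⁻¹ := by rw [L_mul_L]; group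
  have h2 : C.L (C.inv (C.L x y)) = C.L (C.inv x) * C.L (C.inv y) * (C.inner y x)⁻¹ := by
    rw [L_mul_L, inner_inv_inv, inv_L]; group
  rw [P_eq, P_eq, h1, h2]
  group

lemma conj_L_P (x y : Q) : C.L x * C.P y * (C.L x)⁻¹ = C.P (C.L x y) * (C.P x)⁻¹ := by
  rw [P_L, P_eq C x]
  group

lemma P_L_self (x : Q) : C.P (C.L x x) = C.P x * C.P x := by
  rw [P_L, P_eq]
  nth_rw 1 [← P_eq]
  simp only [P, mul_assoc]

lemma commutator_L (x y : Q) :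
    (C.L (C.inv x))⁻¹ * (C.L y)⁻¹ * C.L (C.inv x) * C.L y =
      (C.L x)⁻¹ * (C.L (C.inv y))⁻¹ * C.L x * C.L (C.inv y) := by
  have h : (C.L (C.inv x))⁻¹ * (C.L y)⁻¹ * C.L (C.inv x) * C.L y =
      (C.inner (C.inv x) y)⁻¹ * C.inner y (C.inv x) := by
    rw [inner, inner, C.comm y]; group
  have hJ : MulAut.conj C.J ((C.inner (C.inv x) y)⁻¹ * C.inner y (C.inv x)) =
      (C.inner (C.inv x) y)⁻¹ * C.inner y (C.inv x) := by
    rw [map_mul, _root_.map_inv, conj_J_inner, conj_J_inner]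
  rw [← h] at hJ
  rw [← hJ]
  simp only [map_mul, _root_.map_inv, conj_J_L, inv_inv]

lemma P_L_mul_P_L (x y : Q) :
    C.P (C.L x y) * (C.P y)⁻¹ * (C.P x)⁻¹ * C.P (C.L x y) = C.P y * C.P x := by
  have h := C.commutator_L x y
  nth_rw 1 [C.comm x y]
  rw [P_L, P_L, P_eq, P_eq]
  calc _ = C.L y * C.L x * ((C.L (C.inv x))⁻¹ * (C.L y)⁻¹ * C.L (C.inv x) * C.L y) *
        (C.L (C.inv y))⁻¹ * (C.L (C.inv x))⁻¹ := by group
    _ = _ := by rw [h]; group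

lemma IsAut.fixes_of_sq {C : CommAutomorphicLoop Q}
    (hsq : Function.Injective fun x => C.L x x) {f : Equiv.Perm Q} (hf : C.IsAut f) {a : Q}
    (h : f (C.L a a) = C.L a a) : f a = a := hsq (by simpa [hf.map_mul] using h)

lemma P_apply_e (x : Q) : C.P x C.e = C.L x x := by
  have h := congrArg (fun f => f x) (C.commute_L_inv_L x).eq
  simp only [Equiv.Perm.mul_apply, L_inv_apply, L_apply_e] at h
  rw [P, Equiv.Perm.mul_apply, L_apply_e, Equiv.Perm.inv_eq_iff_eq, h]

lemma inner_apply_eq_iff (x y a : Q) :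
    C.inner x y a = a ↔ C.L y (C.L x a) = C.L (C.L y x) a :=
  (C.L (C.L y x)).symm_apply_eq

lemma inner_fixes_iff_commute (a : Q) :
    (∀ x y, C.inner x y a = a) ↔ ∀ y, Commute (C.L y) (C.L a) := by
  simp only [inner_apply_eq_iff, Commute, SemiconjBy, Equiv.ext_iff, Equiv.Perm.mul_apply]
  rw [forall_comm]
  refine forall₂_congr fun y x => ?_
  rw [C.comm a x, C.comm a]

/-- If `a` is central, then `P_a` commutes with every `P_x`. -/
theorem commute_P_of_inner_apply {a : Q} (h : ∀ x y, C.inner x y a = a) (x : Q) :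
    Commute (C.P a) (C.P x) := by
  have ha := (C.inner_fixes_iff_commute a).mp h
  have ha' := (C.inner_fixes_iff_commute (C.inv a)).mp fun x y => by
    rw [(C.isAut_inner x y).map_inv, h]
  have hP (y : Q) : Commute (C.P a) (C.L y) := (ha' y).symm.inv_left.mul_left (ha y).symm
  exact (hP _).inv_right.mul_right (hP _)

/-- If squaring is injective and `P_a` commutes with every `P_x`, then `a` is central. -/
theorem inner_apply_of_commute_P (hsq : Function.Injective fun x => C.L x x) {a : Q}
    (ha : ∀ x, Commute (C.P a) (C.P x)) (x y : Q) : C.inner x y a = a := by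
  have hL : ∀ x, Commute (C.L x) (C.P a * C.P a) := by
    intro x
    have hZ : ∀ y, Commute (C.P (C.L x a) * (C.P x)⁻¹) (C.P y) := by
      intro y
      obtain ⟨w, rfl⟩ := (C.L x).surjective y
      have h1 : C.P (C.L x w) = C.L x * C.P w * (C.L x)⁻¹ * C.P x := by
        rw [conj_L_P]; group
      have h2 : ∀ w, Commute (C.P (C.L x a) * (C.P x)⁻¹) (C.L x * C.P w * (C.L x)⁻¹) := by
        intro w
        rw [← conj_L_P]
        exact (Commute.conj_iff _).mpr (ha w)
      have h3 : C.P x = C.L x * C.P x * (C.L x)⁻¹ := by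
        rw [eq_mul_inv_iff_mul_eq]
        exact ((C.commute_L_inv_L x).inv_left.mul_left (Commute.refl _)).eq
      rw [h1]
      refine (h2 w).mul_right ?_
      rw [h3]
      simpa [← h3] using h2 x
    have hk := C.P_L_mul_P_L x a
    set Z := C.P (C.L x a) * (C.P x)⁻¹ with hZdef
    have hPZ : C.P (C.L x a) = Z * C.P x := by rw [hZdef]; group
    have hZZ : Z * Z = C.P a * C.P a := by
      rw [hPZ] at hk
      have e : C.P x * (C.P a)⁻¹ * (C.P x)⁻¹ = (C.P a)⁻¹ :=
        mul_inv_eq_iff_eq_mul.mpr (ha x).inv_left.eq.symm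
      rw [mul_assoc Z, mul_assoc Z, e, ← mul_assoc] at hk
      have hk := mul_right_cancel hk
      rwa [(hZ a).inv_right.eq, mul_assoc, inv_mul_eq_iff_eq_mul] at hk
    rw [← conj_L_P] at hZdef
    rw [hZdef] at hZZ
    refine mul_inv_eq_iff_eq_mul.mp ?_
    conv_rhs => rw [← hZZ]
    group
  set d := C.L (C.L a a) (C.L a a)
  have hd' : (C.P a * C.P a) C.e = d := by rw [← P_L_self, P_apply_e]
  have hLd : C.L d = C.P a * C.P a := Equiv.ext fun u => by
    have h := congrArg (fun f => f C.e) (hL u).eq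
    simp only [Equiv.Perm.mul_apply (C.L u), Equiv.Perm.mul_apply _ (C.L u), hd', L_apply_e] at h
    rw [C.comm, h]
  have hfix : C.inner x y d = d :=
    (C.inner_fixes_iff_commute d).mpr (by rwa [hLd]) x y
  exact (C.isAut_inner x y).fixes_of_sq hsq ((C.isAut_inner x y).fixes_of_sq hsq hfix)

end CommAutomorphicLoop

/-- **Theorem 1.2 (centers coincide).** Let `(Q,·,\,1)` be a uniquely 2-divisible
commutative automorphic loop with associated Bruck loop operation
`x ∘ y := √(P_x(y·y))`, where `x⁻¹ := x \ 1`, `P_x(y) := x⁻¹ \ (x·y)` and `√` is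
the inverse of the squaring bijection. Then `a` is central in `(Q,·)`
(equivalently, `a` lies in the right nucleus: `(x·y)·a = x·(y·a)` for all `x,y`)
iff `a` is central in `(Q,∘)` (i.e. `a∘(x∘y) = x∘(a∘y)` for all `x,y`). -/
theorem centers_of_loop_and_associated_bruck_loop_coincide
    (Q : Type) (mul ld : Q → Q → Q) (one : Q)
    (hld1 : ∀ x y : Q, ld x (mul x y) = y)
    (hld2 : ∀ x y : Q, mul x (ld x y) = y)
    (hone1 : ∀ x : Q, mul one x = x)
    (hone2 : ∀ x : Q, mul x one = x)
    (hcomm : ∀ x y : Q, mul x y = mul y x)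
    (hauto : ∀ x y u v : Q,
      ld (mul y x) (mul y (mul x (mul u v))) =
        mul (ld (mul y x) (mul y (mul x u))) (ld (mul y x) (mul y (mul x v))))
    (sqrt : Q → Q)
    (hsqrt1 : ∀ x : Q, mul (sqrt x) (sqrt x) = x)
    (hsqrt2 : ∀ x : Q, sqrt (mul x x) = x)
    (op : Q → Q → Q)
    (hop : ∀ x y : Q, op x y = sqrt (ld (ld x one) (mul x (mul y y))))
    (a : Q) :
    (∀ x y : Q, mul (mul x y) a = mul x (mul y a)) ↔
    (∀ x y : Q, op a (op x y) = op x (op a y)) := by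
  let L (x : Q) : Equiv.Perm Q := ⟨mul x, ld x, hld1 x, hld2 x⟩
  let C : CommAutomorphicLoop Q := ⟨L, one, Equiv.ext hone1, hcomm, hauto⟩
  have hsq : Function.Injective fun x => mul x x := Function.LeftInverse.injective hsqrt2
  have hop_sq (x y : Q) : mul (op x y) (op x y) = C.P x (mul y y) := by
    rw [hop, hsqrt1]; rfl
  have hopc (x y : Q) : op a (op x y) = op x (op a y) ↔
      (C.P a * C.P x) (mul y y) = (C.P x * C.P a) (mul y y) := by
    rw [← hsq.eq_iff]
    simp only [hop_sq, Equiv.Perm.mul_apply]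
  constructor
  · intro h x y
    have ha (u v : Q) : C.inner u v a = a := by
      rw [C.inner_apply_eq_iff]
      exact (h v u).symm
    rw [hopc, (C.commute_P_of_inner_apply ha x).eq]
  · intro h x y
    have ha (u : Q) : Commute (C.P a) (C.P u) := Equiv.ext fun v => by
      rw [← hsqrt1 v]
      exact (hopc u _).mp (h u _)
    exact ((C.inner_apply_eq_iff y x a).mp (C.inner_apply_of_commute_P hsq ha y x)).symm
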